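/- Let p be an odd prime, let R be a nontrivial finite commutative ring in which p·1_R is a unit, and let χ be a non-degenerate additive character of R. Let U = {u^p : u ∈ Rˣ} be the subgroup of p-th powers of units (note -1 ∈ U since p is odd), and suppose the p-unitary Cayley graph Γ(R,U) is connected and its complement graph is also connected. Then the following are equivalent: (1) Γ(R,U) is prime; (2) R is reduced, i.e. R has no nonzero nilpotent elements (equivalently, R is a product of fields); (3) 0 is not an eigenvalue of Γ(R,U), i.e. Σ_{u∈U} χ(r·u) ≠ 0 for every r ∈ R. -/

import Mathlib

open scoped Classical

/-- The Cayley graph of a subset `S` of an additive group: distinct `x, y` are adjacent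
iff `x - y ∈ S` (for a symmetric `S` this coincides with the usual definition). -/
def cayleyGraph {G : Type*} [AddCommGroup G] (S : Set G) : SimpleGraph G :=
  SimpleGraph.fromRel (fun x y => x - y ∈ S)

/-- A set `X` of vertices of a graph is homogeneous if every vertex outside `X` is
adjacent either to all vertices of `X` or to none of them. -/
def IsHomogeneous {V : Type*} (G : SimpleGraph V) (X : Set V) : Prop :=
  ∀ v ∉ X, (∀ x ∈ X, G.Adj v x) ∨ (∀ x ∈ X, ¬ G.Adj v x)

/-- A graph is prime if it has no nontrivial homogeneous set, i.e. no homogeneous set `X`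
with `2 ≤ |X|` and `X` a proper subset of the vertex set. -/
def IsPrimeGraph {V : Type*} (G : SimpleGraph V) : Prop :=
  ¬ ∃ X : Set V, 2 ≤ X.ncard ∧ X ≠ Set.univ ∧ IsHomogeneous G X

/-- In a connected graph, some edge leaves any nonempty proper set of vertices. -/
lemma exists_adj_mem_notMem_of_connected {V : Type*} {G : SimpleGraph V} (hG : G.Connected)
    {B : Set V} {a b : V} (ha : a ∉ B) (hb : b ∈ B) : ∃ x ∉ B, ∃ y ∈ B, G.Adj x y := by
  obtain ⟨w⟩ := hG.preconnected b a
  obtain ⟨d, -, h1, h2⟩ := w.exists_boundary_dart B hb ha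
  exact ⟨d.snd, h2, d.fst, h1, d.adj.symm⟩

lemma IsHomogeneous.adj_iff {V : Type*} {G : SimpleGraph V} {X : Set V}
    (hX : IsHomogeneous G X) {v x y : V} (hv : v ∉ X) (hx : x ∈ X) (hy : y ∈ X) :
    G.Adj v x ↔ G.Adj v y := by
  rcases hX v hv with h | h
  · exact iff_of_true (h x hx) (h y hy)
  · exact iff_of_false (h x hx) (h y hy)

lemma IsHomogeneous.union {V : Type*} {G : SimpleGraph V} {A B : Set V}
    (hA : IsHomogeneous G A) (hB : IsHomogeneous G B) {c : V} (hcA : c ∈ A) (hcB : c ∈ B) :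
    IsHomogeneous G (A ∪ B) := by
  intro v hv
  have hvA : v ∉ A := fun h => hv (Or.inl h)
  have hvB : v ∉ B := fun h => hv (Or.inr h)
  have key : ∀ x ∈ A ∪ B, (G.Adj v x ↔ G.Adj v c) := by
    rintro x (hx | hx)
    · exact hA.adj_iff hvA hx hcA
    · exact hB.adj_iff hvB hx hcB
  by_cases h : G.Adj v c
  · exact Or.inl fun x hx => (key x hx).2 h
  · exact Or.inr fun x hx => fun h' => h ((key x hx).1 h')

/-- Two proper homogeneous sets of a connected, anti-connected graph do not cover it. -/
lemma IsHomogeneous.union_ne_univ {V : Type*} {G : SimpleGraph V}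
    (hG : G.Connected) (hGc : Gᶜ.Connected) {A B : Set V}
    (hA : IsHomogeneous G A) (hB : IsHomogeneous G B) (hA' : A ≠ Set.univ) (hB' : B ≠ Set.univ) :
    A ∪ B ≠ Set.univ := by
  intro h
  obtain ⟨a, ha⟩ := (Set.ne_univ_iff_exists_notMem B).1 hB'
  obtain ⟨b, hb⟩ := (Set.ne_univ_iff_exists_notMem A).1 hA'
  have mem_A : ∀ x, x ∉ B → x ∈ A := fun x hx =>
    ((h ▸ Set.mem_univ x : x ∈ A ∪ B)).resolve_right hx
  have hbB : b ∈ B := ((h ▸ Set.mem_univ b : b ∈ A ∪ B)).resolve_left hb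
  have key : ∀ x ∉ B, ∀ y ∈ B, (G.Adj x y ↔ G.Adj a b) := by
    intro x hx y hy
    rw [hB.adj_iff hx hy hbB, G.adj_comm x b, hA.adj_iff hb (mem_A x hx) (mem_A a ha),
      G.adj_comm]
  by_cases hab : G.Adj a b
  · obtain ⟨x, hx, y, hy, hxy⟩ := exists_adj_mem_notMem_of_connected hGc ha hbB
    exact ((SimpleGraph.compl_adj G x y).1 hxy).2 ((key x hx y hy).2 hab)
  · obtain ⟨x, hx, y, hy, hxy⟩ := exists_adj_mem_notMem_of_connected hG ha hbB
    exact hab ((key x hx y hy).1 hxy)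

/-- A finite vertex-transitive graph which is connected and anti-connected but not prime has,
through any vertex, a nontrivial homogeneous set which contains each of its automorphic images
meeting it. -/
lemma exists_homogeneous_block {V : Type*} [Finite V] {G : SimpleGraph V}
    (hG : G.Connected) (hGc : Gᶜ.Connected) (h : ¬ IsPrimeGraph G) (o : V)
    (htrans : ∀ v : V, ∃ φ : G ≃g G, φ v = o) :
    ∃ X : Set V, o ∈ X ∧ 2 ≤ X.ncard ∧ X ≠ Set.univ ∧ IsHomogeneous G X ∧
      ∀ φ : G ≃g G, ∀ x ∈ X, φ x ∈ X → ∀ y ∈ X, φ y ∈ X := by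
  have himage : ∀ (φ : G ≃g G) (X : Set V), IsHomogeneous G X → IsHomogeneous G (φ '' X) := by
    intro φ X hX v hv
    have hv' : φ.symm v ∉ X := fun h' => hv ⟨_, h', by simp⟩
    have hadj : ∀ x, G.Adj v (φ x) ↔ G.Adj (φ.symm v) x := fun x => by
      rw [← φ.map_adj_iff (v := φ.symm v), φ.apply_symm_apply]
    simpa only [Set.forall_mem_image, hadj] using hX _ hv'
  have huniv : ∀ (φ : G ≃g G) (X : Set V), X ≠ Set.univ → φ '' X ≠ Set.univ := by
    intro φ X hX h'
    apply hX
    rw [← Set.image_eq_image φ.injective, h', Set.image_univ, φ.surjective.range_eq]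
  rw [IsPrimeGraph, not_not] at h
  obtain ⟨X, hXmax⟩ := (Set.toFinite {X : Set V | 2 ≤ X.ncard ∧ X ≠ Set.univ ∧
    IsHomogeneous G X}).exists_maximalFor Set.ncard _ h
  obtain ⟨⟨hX2, hXu, hXh⟩, hmax⟩ := hXmax
  obtain ⟨v, hv⟩ : X.Nonempty := Set.nonempty_of_ncard_ne_zero (by omega)
  obtain ⟨τ, hτ⟩ := htrans v
  have hcard : ∀ (φ : G ≃g G) (Y : Set V), (φ '' Y).ncard = Y.ncard := fun φ Y =>
    Set.ncard_image_of_injective Y φ.injective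
  refine ⟨τ '' X, ⟨v, hv, hτ⟩, by rwa [hcard], huniv τ X hXu, himage τ X hXh, ?_⟩
  intro φ x hx hφx y hy
  set Y := τ '' X with hY
  have hYh : IsHomogeneous G Y := himage τ X hXh
  have hYu : Y ≠ Set.univ := huniv τ X hXu
  have hle : Y.ncard ≤ (Y ∪ φ '' Y).ncard :=
    Set.ncard_le_ncard Set.subset_union_left (Set.toFinite _)
  have hYX : Y.ncard = X.ncard := hcard τ X
  have h1 : (Y ∪ φ '' Y).ncard ≤ X.ncard := by
    apply hmax (j := Y ∪ φ '' Y) _ (by omega)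
    exact ⟨by omega, hYh.union_ne_univ hG hGc (himage φ Y hYh) hYu (huniv φ Y hYu),
      hYh.union (himage φ Y hYh) hφx ⟨x, hx, rfl⟩⟩
  have h2 : Y = Y ∪ φ '' Y :=
    Set.eq_of_subset_of_ncard_le Set.subset_union_left (by omega) (Set.toFinite _)
  rw [h2]
  exact Or.inr ⟨y, hy, rfl⟩

lemma cayleyGraph_adj {G : Type*} [AddCommGroup G] {S : Set G} (h0 : (0 : G) ∉ S)
    (hS : ∀ s ∈ S, -s ∈ S) {x y : G} : (cayleyGraph S).Adj x y ↔ x - y ∈ S := by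
  rw [cayleyGraph, SimpleGraph.fromRel_adj]
  constructor
  · rintro ⟨-, h | h⟩
    · exact h
    · simpa using hS _ h
  · intro h
    exact ⟨fun hxy => h0 (by simpa [hxy] using h), Or.inl h⟩

/-- In a connected Cayley graph every additive subgroup containing `S` is everything. -/
lemma AddSubgroup.eq_top_of_cayleyGraph_connected {G : Type*} [AddCommGroup G] {S : Set G}
    (h0 : (0 : G) ∉ S) (hS : ∀ s ∈ S, -s ∈ S) (hconn : (cayleyGraph S).Connected)
    (H : AddSubgroup G) (hH : S ⊆ H) : H = ⊤ := by
  by_contra hne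
  obtain ⟨a, -, ha⟩ := SetLike.exists_of_lt (lt_top_iff_ne_top.2 hne)
  obtain ⟨x, hx, y, hy, hxy⟩ := exists_adj_mem_notMem_of_connected hconn
    (B := (H : Set G)) ha H.zero_mem
  rw [cayleyGraph_adj h0 hS] at hxy
  exact hx (by simpa using H.add_mem (hH hxy) hy)

/-- The Hensel lift: a unipotent element is a `p`-th power of a unit if `p` is invertible. -/
lemma exists_unit_pow_eq_one_add {R : Type*} [CommRing R] {p : ℕ} (hpu : IsUnit (p : R))
    {n : R} (hn : IsNilpotent n) : ∃ u : Rˣ, (u : R) ^ p = 1 + n := by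
  obtain ⟨r, ⟨hr1, hr2⟩, -⟩ := Polynomial.existsUnique_nilpotent_sub_and_aeval_eq_zero
    (P := (Polynomial.X ^ p - Polynomial.C (1 + n) : Polynomial R)) (x := (1 : R))
    (by simpa using hn) (by simpa [Polynomial.derivative_X_pow] using hpu)
  have hu : IsUnit r := by
    have := hr1.isUnit_one_sub
    simpa using this
  refine ⟨hu.unit, ?_⟩
  simpa [sub_eq_zero] using hr2

/-- A sum of `ℓ`-th roots of unity, `ℓ` prime, vanishes only if `ℓ` divides the number of
summands. -/
lemma prime_dvd_card_of_sum_eq_zero {ι : Type*} {ℓ : ℕ} (hℓ : ℓ.Prime) (T : Finset ι)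
    (f : ι → ℂ) (hf : ∀ i, f i ^ ℓ = 1) (hsum : ∑ i ∈ T, f i = 0) : ℓ ∣ T.card := by
  have : Fact ℓ.Prime := ⟨hℓ⟩
  have : NeZero ℓ := ⟨hℓ.ne_zero⟩
  have hζ := Complex.isPrimitiveRoot_exp ℓ hℓ.ne_zero
  set ζ := Complex.exp (2 * Real.pi * Complex.I / ℓ)
  choose a _ ha using fun i => hζ.eq_pow_of_pow_eq_one (hf i)
  have hdvd : Polynomial.cyclotomic ℓ ℤ ∣ ∑ i ∈ T, Polynomial.X ^ a i := by
    rw [Polynomial.cyclotomic_eq_minpoly hζ hℓ.pos]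
    apply minpoly.isIntegrallyClosed_dvd (hζ.isIntegral hℓ.pos)
    simpa [ha] using hsum
  have h1 := map_dvd (Polynomial.evalRingHom (1 : ℤ)) hdvd
  simp only [Polynomial.coe_evalRingHom, Polynomial.eval_one_cyclotomic_prime,
    Polynomial.eval_finsetSum, Polynomial.eval_pow, Polynomial.eval_X, one_pow,
    Finset.sum_const, nsmul_eq_mul, mul_one] at h1
  exact_mod_cast h1

/-- Gaussian periods over a finite field do not vanish. -/
lemma sum_addChar_pow_units_ne_zero {K : Type*} [Field K] [Fintype K] (p : ℕ)
    (ψ : AddChar K ℂ) :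
    ∑ x ∈ Finset.univ.filter (fun x : K => ∃ u : Kˣ, (u : K) ^ p = x), ψ x ≠ 0 := by
  intro hsum
  obtain ⟨ℓ, _, n, hℓ, hcard⟩ := FiniteField.card' K
  have hchar : (ℓ : K) = 0 := CharP.cast_eq_zero K ℓ
  have hdvd := prime_dvd_card_of_sum_eq_zero hℓ _ ψ
    (fun x => by rw [← AddChar.map_nsmul_eq_pow, nsmul_eq_mul, hchar]; simp) hsum
  have hT : (Finset.univ.filter (fun x : K => ∃ u : Kˣ, (u : K) ^ p = x)).card =
      Nat.card (powMonoidHom p : Kˣ →* Kˣ).range := by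
    have himage : ((Finset.univ.filter fun x : K => ∃ u : Kˣ, (u : K) ^ p = x : Finset K) : Set K) =
        Units.val '' ((powMonoidHom p : Kˣ →* Kˣ).range : Set Kˣ) := by
      ext x
      simp
    rw [← Set.ncard_coe_finset, himage, Set.ncard_image_of_injective _ Units.val_injective]
    exact Nat.card_coe_set_eq _
  have h1 : ℓ ∣ Fintype.card K - 1 := by
    rw [← Fintype.card_units, ← Nat.card_eq_fintype_card]
    exact (hT ▸ hdvd).trans (Subgroup.card_subgroup_dvd_card _)
  have h2 : ℓ ∣ Fintype.card K := hcard ▸ dvd_pow_self ℓ n.ne_zero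
  have h3 : ℓ ∣ 1 := by
    have := Nat.dvd_sub h2 h1
    rwa [Nat.sub_sub_self Fintype.card_pos] at this
  exact hℓ.one_lt.ne' (Nat.dvd_one.1 h3)

lemma addChar_map_sum {ι A M : Type*} [AddCommMonoid A] [CommMonoid M] (ψ : AddChar A M)
    (s : Finset ι) (f : ι → A) : ψ (∑ i ∈ s, f i) = ∏ i ∈ s, ψ (f i) := by
  induction s using Finset.induction_on with
  | empty => simp
  | insert i s hi ih => rw [Finset.sum_insert hi, Finset.prod_insert hi, AddChar.map_add_eq_mul, ih]

/-- Over a finite reduced ring, character sums over `p`-th powers of units do not vanish. -/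
lemma sum_addChar_pow_units_ne_zero_of_isReduced {R : Type*} [CommRing R] [Fintype R]
    [IsReduced R] (p : ℕ) (ψ : AddChar R ℂ) :
    ∑ x ∈ Finset.univ.filter (fun x : R => ∃ u : Rˣ, (u : R) ^ p = x), ψ x ≠ 0 := by
  let _ : ∀ I : MaximalSpectrum R, Field (R ⧸ I.asIdeal) := fun I => Ideal.Quotient.field I.asIdeal
  let _ : Fintype (MaximalSpectrum R) := Fintype.ofFinite _
  let _ : ∀ I : MaximalSpectrum R, Fintype (R ⧸ I.asIdeal) := fun I => Fintype.ofFinite _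
  let e : R ≃+* ∀ I : MaximalSpectrum R, R ⧸ I.asIdeal := IsArtinianRing.equivPi R
  let ψ' : ∀ I : MaximalSpectrum R, AddChar (R ⧸ I.asIdeal) ℂ := fun I =>
    ψ.compAddMonoidHom ((e.symm : (∀ I : MaximalSpectrum R, R ⧸ I.asIdeal) →+ R).comp
      (AddMonoidHom.single (fun I : MaximalSpectrum R => R ⧸ I.asIdeal) I))
  have hprod : ∀ y, ψ (e.symm y) = ∏ I, ψ' I (y I) := by
    intro y
    conv_lhs => rw [← Finset.univ_sum_single y, map_sum, addChar_map_sum]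
    rfl
  have hmem : ∀ x : R, (∃ u : Rˣ, (u : R) ^ p = x) ↔
      ∀ I, ∃ u : (R ⧸ I.asIdeal)ˣ, (u : R ⧸ I.asIdeal) ^ p = e x I := by
    intro x
    constructor
    · rintro ⟨u, rfl⟩ I
      exact ⟨Units.map ((Pi.evalRingHom _ I).comp e.toRingHom : R →* R ⧸ I.asIdeal) u, by simp⟩
    · intro h
      choose u hu using h
      refine ⟨Units.map (e.symm : _ →* R) (MulEquiv.piUnits.symm u), ?_⟩
      apply e.injective
      ext I
      simp [hu]
  have hsum : ∑ x ∈ Finset.univ.filter (fun x : R => ∃ u : Rˣ, (u : R) ^ p = x), ψ x =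
      ∏ I : MaximalSpectrum R, ∑ x ∈ Finset.univ.filter
        (fun x : R ⧸ I.asIdeal => ∃ u : (R ⧸ I.asIdeal)ˣ, (u : R ⧸ I.asIdeal) ^ p = x), ψ' I x := by
    rw [Finset.prod_univ_sum]
    refine Finset.sum_equiv e.toEquiv ?_ ?_
    · intro x
      simp [hmem]
    · intro x _
      rw [← hprod]
      simp
  rw [hsum, Finset.prod_ne_zero_iff]
  exact fun I _ => sum_addChar_pow_units_ne_zero p (ψ' I)

/-- The set of `p`-th powers of units is stable under translation by nilpotents. -/
lemma exists_unit_pow_eq_add {R : Type*} [CommRing R] {p : ℕ} (hpu : IsUnit (p : R))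
    {n x : R} (hn : IsNilpotent n) (hx : ∃ u : Rˣ, (u : R) ^ p = x) :
    ∃ u : Rˣ, (u : R) ^ p = x + n := by
  obtain ⟨u, rfl⟩ := hx
  have hn' : IsNilpotent (((u ^ p)⁻¹ : Rˣ) * n) := (Commute.all _ _).isNilpotent_mul_left hn
  obtain ⟨v, hv⟩ := exists_unit_pow_eq_one_add hpu hn'
  refine ⟨u * v, ?_⟩
  rw [Units.val_mul, mul_pow, hv, mul_add, mul_one, ← mul_assoc, ← Units.val_pow_eq_pow_val,
    Units.mul_inv, one_mul]

/-- If `R` is reduced, the `p`-unitary Cayley graph is prime as soon as it is connected and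
anti-connected. -/
lemma isPrimeGraph_of_isReduced {R : Type*} [CommRing R] [Finite R] [Nontrivial R]
    [IsReduced R] {p : ℕ} (hodd : Odd p)
    (hconn : (cayleyGraph {x : R | ∃ u : Rˣ, (u : R) ^ p = x}).Connected)
    (hanti : (cayleyGraph {x : R | ∃ u : Rˣ, (u : R) ^ p = x})ᶜ.Connected) :
    IsPrimeGraph (cayleyGraph {x : R | ∃ u : Rˣ, (u : R) ^ p = x}) := by
  set S : Set R := {x : R | ∃ u : Rˣ, (u : R) ^ p = x} with hSdef
  have hunit : ∀ s ∈ S, IsUnit s := by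
    rintro _ ⟨u, rfl⟩
    exact u.isUnit.pow p
  have h0 : (0 : R) ∉ S := fun h => not_isUnit_zero (hunit 0 h)
  have hneg : ∀ s ∈ S, -s ∈ S := by
    rintro _ ⟨u, rfl⟩
    exact ⟨-u, by rw [Units.val_neg, hodd.neg_pow]⟩
  have hone : (1 : R) ∈ S := ⟨1, by simp⟩
  have hadj : ∀ {x y : R}, (cayleyGraph S).Adj x y ↔ x - y ∈ S := cayleyGraph_adj h0 hneg
  let trans (a : R) : cayleyGraph S ≃g cayleyGraph S :=
    { Equiv.subRight a with map_rel_iff' := by intro x y; simp [hadj] }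
  let scale (u : Rˣ) : cayleyGraph S ≃g cayleyGraph S :=
    { Units.mulLeft (u ^ p) with
      map_rel_iff' := by
        intro x y
        simp only [Units.mulLeft_apply, hadj, ← mul_sub]
        constructor
        · rintro ⟨v, hv⟩
          refine ⟨u⁻¹ * v, ?_⟩
          rw [Units.val_mul, mul_pow, hv, ← mul_assoc, Units.val_pow_eq_pow_val, ← mul_pow,
            Units.inv_mul, one_pow, one_mul]
        · rintro ⟨v, hv⟩
          exact ⟨u * v, by simp [mul_pow, hv]⟩ }
  by_contra hnp
  obtain ⟨X, hX0, hX2, hXu, hXh, hX⟩ := exists_homogeneous_block hconn hanti hnp (0 : R)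
    (fun v => ⟨trans v, sub_self v⟩)
  have hsub : ∀ x ∈ X, ∀ y ∈ X, y - x ∈ X := fun x hx y hy =>
    hX (trans x) x hx (by simpa [trans] using hX0) y hy
  have hnegX : ∀ x ∈ X, -x ∈ X := fun x hx => by simpa using hsub x hx 0 hX0
  have haddX : ∀ x ∈ X, ∀ y ∈ X, x + y ∈ X := fun x hx y hy => by
    simpa using hsub (-y) (hnegX y hy) x hx
  let H : AddSubgroup R :=
    { carrier := {r | ∀ x ∈ X, r * x ∈ X}
      zero_mem' := fun x _ => by simpa using hX0
      add_mem' := fun {a b} ha hb x hx => by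
        rw [add_mul]; exact haddX _ (ha x hx) _ (hb x hx)
      neg_mem' := fun {a} ha x hx => by
        rw [neg_mul]; exact hnegX _ (ha x hx) }
  have hH : H = ⊤ := by
    apply AddSubgroup.eq_top_of_cayleyGraph_connected h0 hneg hconn
    rintro _ ⟨u, rfl⟩ x hx
    exact hX (scale u) 0 hX0 (by simpa [scale] using hX0) x hx
  have hmul : ∀ r, ∀ x ∈ X, r * x ∈ X := fun r => (hH ▸ AddSubgroup.mem_top r : r ∈ H)
  have hone_notMem : (1 : R) ∉ X := fun h1 => hXu <| Set.eq_univ_of_forall fun r => by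
    simpa using hmul r 1 h1
  let I : Ideal R :=
    { carrier := X
      zero_mem' := hX0
      add_mem' := fun {a b} ha hb => haddX a ha b hb
      smul_mem' := hmul }
  have hI : I ≤ Ring.jacobson R := by
    intro x hx
    rw [← Ideal.jacobson_bot, Ideal.mem_jacobson_bot]
    intro y
    have hxy : -(x * y) ∈ X := hnegX _ (by rw [mul_comm]; exact hmul y x hx)
    have h1 : (cayleyGraph S).Adj 1 (-(x * y)) :=
      (hXh.adj_iff hone_notMem hX0 hxy).1 (hadj.2 (by simpa using hone))
    have h2 := hunit _ (hadj.1 h1)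
    rwa [sub_neg_eq_add, add_comm] at h2
  have hI0 : I = ⊥ := by
    rw [eq_bot_iff]
    rwa [Ring.jacobson_eq_nilradical_of_krullDimLE_zero, nilradical_eq_zero] at hI
  have hX1 : X = {0} := by
    ext x
    exact (SetLike.ext_iff.1 hI0 x).trans (by simp)
  rw [hX1, Set.ncard_singleton] at hX2
  omega

lemma isReduced_of_isPrimeGraph {R : Type*} [CommRing R] [Finite R] [Nontrivial R]
    {p : ℕ} (hodd : Odd p) (hpu : IsUnit (p : R))
    (hprime : IsPrimeGraph (cayleyGraph {x : R | ∃ u : Rˣ, (u : R) ^ p = x})) :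
    IsReduced R := by
  set S : Set R := {x : R | ∃ u : Rˣ, (u : R) ^ p = x} with hSdef
  have h0 : (0 : R) ∉ S := by
    rintro ⟨u, hu⟩
    exact not_isUnit_zero (hu ▸ u.isUnit.pow p)
  have hneg : ∀ s ∈ S, -s ∈ S := by
    rintro _ ⟨u, rfl⟩
    exact ⟨-u, by rw [Units.val_neg, hodd.neg_pow]⟩
  refine ⟨fun n hn => ?_⟩
  by_contra hn0
  refine hprime ⟨{x | IsNilpotent x}, ?_, ?_, ?_⟩
  · rw [← Set.ncard_pair (Ne.symm hn0)]
    refine Set.ncard_le_ncard ?_ (Set.toFinite _)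
    rintro x (rfl | rfl)
    · exact IsNilpotent.zero
    · exact hn
  · intro h
    exact not_isNilpotent_one (h ▸ Set.mem_univ (1 : R) : (1 : R) ∈ {x : R | IsNilpotent x})
  · intro v _
    have key : ∀ x, IsNilpotent x → ((cayleyGraph S).Adj v x ↔ v ∈ S) := by
      intro x hx
      rw [cayleyGraph_adj h0 hneg]
      constructor
      · intro h
        have := exists_unit_pow_eq_add hpu hx h
        rwa [sub_add_cancel] at this
      · intro h
        rw [sub_eq_add_neg]
        exact exists_unit_pow_eq_add hpu hx.neg h
    by_cases hv : v ∈ S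
    · exact Or.inl fun x hx => (key x hx).2 hv
    · exact Or.inr fun x hx h => hv ((key x hx).1 h)

lemma isReduced_of_sum_addChar_ne_zero {R : Type*} [CommRing R] [Fintype R]
    {p : ℕ} (hpu : IsUnit (p : R)) (χ : AddChar R ℂ)
    (hnd : ∀ I : Ideal R, (∀ x ∈ I, χ x = 1) → I = ⊥)
    (h : ∀ r : R, ∑ x ∈ Finset.univ.filter (fun x : R => ∃ u : Rˣ, (u : R) ^ p = x),
      χ (r * x) ≠ 0) : IsReduced R := by
  refine ⟨fun n hn => ?_⟩
  rw [← Ideal.span_singleton_eq_bot]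
  refine hnd _ fun y hy => ?_
  obtain ⟨r, rfl⟩ := Ideal.mem_span_singleton'.1 hy
  have hshift : ∑ x ∈ Finset.univ.filter (fun x : R => ∃ u : Rˣ, (u : R) ^ p = x), χ (r * x) =
      ∑ x ∈ Finset.univ.filter (fun x : R => ∃ u : Rˣ, (u : R) ^ p = x),
        χ (r * n) * χ (r * x) := by
    symm
    refine Finset.sum_equiv (Equiv.addRight n) ?_ ?_
    · intro x
      simp only [Finset.mem_filter, Finset.mem_univ, true_and, Equiv.coe_addRight]
      refine ⟨exists_unit_pow_eq_add hpu hn, fun h' => ?_⟩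
      simpa using exists_unit_pow_eq_add hpu hn.neg h'
    · intro x _
      rw [Equiv.coe_addRight, mul_add, AddChar.map_add_eq_mul, mul_comm]
  rw [← Finset.mul_sum] at hshift
  exact (mul_eq_right₀ (h r)).1 hshift.symm

/-- Let `p` be an odd prime, `R` a nontrivial finite commutative ring
in which `p·1_R` is a unit, and `χ` a non-degenerate additive character of `R`. Let
`U = {u^p : u ∈ Rˣ}` and suppose the `p`-unitary Cayley graph `Γ(R,U)` is connected and
anti-connected. Then the following are equivalent: (1) `Γ(R,U)` is prime; (2) `R` is
reduced; (3) `0` is not an eigenvalue of `Γ(R,U)`, i.e. `Σ_{u∈U} χ(r·u) ≠ 0` for every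
`r ∈ R`. -/
theorem stmt17 {R : Type*} [CommRing R] [Fintype R] [Nontrivial R]
    (p : ℕ) (hp : p.Prime) (hodd : Odd p) (hpu : IsUnit (p : R))
    (χ : AddChar R ℂ)
    (hnd : ∀ I : Ideal R, (∀ x ∈ I, χ x = 1) → I = ⊥)
    (hconn : (cayleyGraph {x : R | ∃ u : Rˣ, ((u : R)) ^ p = x}).Connected)
    (hanti : ((cayleyGraph {x : R | ∃ u : Rˣ, ((u : R)) ^ p = x})ᶜ).Connected) :
    (IsPrimeGraph (cayleyGraph {x : R | ∃ u : Rˣ, ((u : R)) ^ p = x}) ↔ IsReduced R) ∧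
      (IsReduced R ↔
        ∀ r : R,
          ∑ x ∈ Finset.univ.filter (fun x : R => ∃ u : Rˣ, ((u : R)) ^ p = x),
            χ (r * x) ≠ 0) := by
  refine ⟨⟨isReduced_of_isPrimeGraph hodd hpu, fun _ => isPrimeGraph_of_isReduced hodd hconn hanti⟩,
    fun _ r => ?_, isReduced_of_sum_addChar_ne_zero hpu χ hnd⟩
  exact sum_addChar_pow_units_ne_zero_of_isReduced p
    (χ.compAddMonoidHom (AddMonoidHom.mulLeft r))
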